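/- If S ≤ L, then there exists a constant k > 0 such that for every N ≥ 2, N · D(ξ_1, ξ_2, …, ξ_N) ≤ k · log N; that is, the LS-sequence of points has low discrepancy. -/

import Mathlib

/-- The coefficient `b(i)`: `b(i) = i` if `i ≤ L−1` and `b(i) = L + (i−L)γ` if `i ≥ L`. -/
noncomputable def bcoef (L : ℕ) (γ : ℝ) (i : ℕ) : ℝ :=
  if i < L then (i : ℝ) else (L : ℝ) + ((i : ℝ) - (L : ℝ)) * γ

/-- The LS-radical inverse function `φ_{L,S}(n) = Σ_k b(a_k(n)) γ^{k+1}`, where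
`a_0(n), a_1(n), …` are the digits of `n` in base `L + S`. -/
noncomputable def phiLS (L S : ℕ) (γ : ℝ) (n : ℕ) : ℝ :=
  ∑ k ∈ Finset.range (Nat.digits (L + S) n).length,
    bcoef L γ ((Nat.digits (L + S) n).getD k 0) * γ ^ (k + 1)

/-- Membership in `ℕ_{L,S}`: the base-`(L+S)` digit string of `n` has no consecutive pair
`(a_k, a_{k+1})` in `E_{L,S} = {L,…,L+S−1} × {1,…,L+S−1}`. -/
def memNLS (L S : ℕ) (n : ℕ) : Prop :=
  (Nat.digits (L + S) n).Chain' fun a b => ¬(L ≤ a ∧ 1 ≤ b)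

/-- The first `N` terms `(ξ_1, …, ξ_N)` of the LS-sequence of points:
`ξ_N = φ_{L,S}(m_N)`, where `m_1 < m_2 < ⋯` enumerates `ℕ_{L,S}` increasingly. -/
noncomputable def lsPoints (L S : ℕ) (γ : ℝ) (N : ℕ) : List ℝ :=
  (List.range N).map fun j => phiLS L S γ (Nat.nth (memNLS L S) j)

/-- The discrepancy of a finite list `(y_1, …, y_t)` of points of `[0,1)`:
`D = sup_{0 ≤ a < b ≤ 1} | (1/t)·#{j : y_j ∈ [a,b)} − (b−a) |`. -/
noncomputable def discList (ys : List ℝ) : ℝ :=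
  sSup {d : ℝ | ∃ a b : ℝ, 0 ≤ a ∧ a < b ∧ b ≤ 1 ∧
    d = |((ys.countP fun y => decide (a ≤ y ∧ y < b)) : ℝ) / (ys.length : ℝ) - (b - a)|}

open Finset

/-- The modulus fixing the leading block of digits of an element of `ℕ_{L,S}` with first digit `i`. -/
def blockModulus (L S i : ℕ) : ℕ := if i < L then L + S else (L + S) ^ 2

/-- The length of the elementary interval attached to the first digit `i`. -/
noncomputable def blockLength (L : ℕ) (γ : ℝ) (i : ℕ) : ℝ := if i < L then γ else γ ^ 2

open Classical in
/-- The number of `n < X` satisfying `P`. -/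
noncomputable def countBelow (P : ℕ → Prop) (X : ℕ) : ℕ := #{n ∈ range X | P n}

theorem countBelow_zero (P : ℕ → Prop) : countBelow P 0 = 0 := by simp [countBelow]

theorem countBelow_congr {P Q : ℕ → Prop} (h : ∀ n, P n ↔ Q n) (X : ℕ) :
    countBelow P X = countBelow Q X := by
  obtain rfl : P = Q := funext fun n => propext (h n)
  rfl

theorem countBelow_mono {P Q : ℕ → Prop} (h : ∀ n, P n → Q n) {X Y : ℕ} (hXY : X ≤ Y) :
    countBelow P X ≤ countBelow Q Y := by
  classical
  refine card_le_card fun n hn => ?_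
  simp only [mem_filter, mem_range] at hn ⊢
  exact ⟨hn.1.trans_le hXY, h n hn.2⟩

theorem countBelow_succ_le (P : ℕ → Prop) (X : ℕ) :
    countBelow P (X + 1) ≤ countBelow P X + 1 := by
  classical
  unfold countBelow
  rw [range_add_one, filter_insert]
  split_ifs
  · exact card_insert_le _ _
  · omega

theorem countBelow_eq_sum (P : ℕ → Prop) {B : ℕ} (hB : 0 < B) (X : ℕ) :
    countBelow P X = ∑ i ∈ range B, countBelow (fun n => P n ∧ n % B = i) X := by
  classical
  unfold countBelow
  rw [card_eq_sum_card_fiberwise (f := fun n => n % B) (t := range B)]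
  · simp only [filter_filter]
  · intro n _
    simpa using Nat.mod_lt n hB

/-- Counting along an arithmetic progression of modulus `q`. -/
theorem countBelow_progression {P Q : ℕ → Prop} {q r : ℕ} (hr : r < q)
    (hPr : ∀ n, P n → n % q = r) (hPQ : ∀ m, P (r + q * m) ↔ Q m) (X : ℕ) :
    countBelow Q (X / q) ≤ countBelow P X ∧ countBelow P X ≤ countBelow Q (X / q) + 1 := by
  classical
  have hq : 0 < q := by omega
  constructor
  · refine card_le_card_of_injOn (fun m => r + q * m) (fun m hm => ?_) fun a _ b _ h => ?_
    · simp only [coe_filter, Set.mem_ofPred_eq, mem_range] at hm ⊢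
      refine ⟨?_, (hPQ m).2 hm.2⟩
      have h1 : q * (m + 1) ≤ q * (X / q) := Nat.mul_le_mul_left q hm.1
      have h2 := Nat.mul_div_le X q
      rw [mul_add] at h1
      omega
    · exact Nat.eq_of_mul_eq_mul_left hq (by simpa using h)
  · refine le_trans ?_ (countBelow_succ_le Q (X / q))
    refine card_le_card_of_injOn (fun n => n / q) (fun n hn => ?_) fun a ha b hb h => ?_
    · simp only [coe_filter, Set.mem_ofPred_eq, mem_range] at hn ⊢
      refine ⟨Nat.lt_succ_of_le (Nat.div_le_div_right hn.1.le), (hPQ _).1 ?_⟩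
      rw [← hPr n hn.2, Nat.mod_add_div]
      exact hn.2
    · simp only [coe_filter, Set.mem_ofPred_eq, mem_range] at ha hb h
      rw [← Nat.mod_add_div a q, ← Nat.mod_add_div b q, hPr a ha.2, hPr b hb.2, h]

theorem memNLS_iff_isChain (L S n : ℕ) :
    memNLS L S n ↔ (Nat.digits (L + S) n).IsChain fun a b => ¬(L ≤ a ∧ 1 ≤ b) := Iff.rfl

theorem memNLS_zero (L S : ℕ) : memNLS L S 0 := by
  simp [memNLS_iff_isChain]

theorem memNLS_digit_add {L S i : ℕ} (hLS : 2 ≤ L + S) (hi : i < L + S) (m : ℕ) :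
    memNLS L S (i + (L + S) * m) ↔ memNLS L S m ∧ ¬(L ≤ i ∧ 1 ≤ m % (L + S)) := by
  rcases Nat.eq_zero_or_pos m with rfl | hm
  · rcases Nat.eq_zero_or_pos i with rfl | hi0
    · simp [memNLS_zero]
    · simp [memNLS_iff_isChain, Nat.digits_of_lt _ _ hi0.ne' hi]
  · rw [memNLS_iff_isChain, memNLS_iff_isChain, Nat.digits_add _ (by omega) _ _ hi (Or.inr hm.ne'), Nat.digits_def' (by omega) hm,
      List.isChain_cons_cons, and_comm]

theorem memNLS_mul {L S : ℕ} (hL : 1 ≤ L) (hLS : 2 ≤ L + S) (m : ℕ) :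
    memNLS L S ((L + S) * m) ↔ memNLS L S m := by
  have := memNLS_digit_add (L := L) (i := 0) hLS (by omega) m
  rw [zero_add] at this
  rw [this]
  have : ¬ L ≤ 0 := by omega
  simp [this]

theorem memNLS_block {L S i : ℕ} (hL : 1 ≤ L) (hLS : 2 ≤ L + S) (hi : i < L + S) (m : ℕ) :
    memNLS L S (i + blockModulus L S i * m) ↔ memNLS L S m := by
  unfold blockModulus
  split_ifs with h
  · rw [memNLS_digit_add hLS hi]
    simp [h.not_ge]
  · rw [pow_two, mul_assoc, memNLS_digit_add hLS hi, memNLS_mul hL hLS]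
    simp

theorem lt_blockModulus {L S i : ℕ} (hi : i < L + S) : i < blockModulus L S i := by
  unfold blockModulus
  split_ifs
  · exact hi
  · nlinarith

theorem mod_blockModulus {L S i n : ℕ} (hLS : 2 ≤ L + S) (hi : i < L + S) (hn : memNLS L S n)
    (hni : n % (L + S) = i) : n % blockModulus L S i = i := by
  unfold blockModulus
  split_ifs with h
  · exact hni
  · rw [← Nat.mod_add_div n (L + S), hni, memNLS_digit_add hLS hi] at hn
    have h0 : n / (L + S) % (L + S) = 0 := by
      by_contra h0
      exact hn.2 ⟨by omega, by omega⟩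
    rw [pow_two, Nat.mod_mul, h0, hni, mul_zero, add_zero]

theorem add_blockModulus_mod {L S i : ℕ} (hi : i < L + S) (m : ℕ) :
    (i + blockModulus L S i * m) % (L + S) = i := by
  unfold blockModulus
  split_ifs
  · rw [Nat.add_mul_mod_self_left, Nat.mod_eq_of_lt hi]
  · rw [pow_two, mul_assoc, Nat.add_mul_mod_self_left, Nat.mod_eq_of_lt hi]

theorem phiLS_digit_add {L S i : ℕ} (hL : 1 ≤ L) (hLS : 2 ≤ L + S) (hi : i < L + S) (γ : ℝ)
    (m : ℕ) : phiLS L S γ (i + (L + S) * m) = bcoef L γ i * γ + γ * phiLS L S γ m := by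
  by_cases h : i ≠ 0 ∨ m ≠ 0
  · unfold phiLS
    rw [Nat.digits_add _ (by omega) _ _ hi h, List.length_cons, sum_range_succ', mul_sum, add_comm]
    simp only [List.getD_cons_zero, List.getD_cons_succ, zero_add, pow_one]
    congr 1
    exact sum_congr rfl fun k _ => by ring
  · push Not at h
    obtain ⟨rfl, rfl⟩ := h
    simp [phiLS, bcoef, show 0 < L by omega]

theorem phiLS_block {L S i : ℕ} (hL : 1 ≤ L) (hLS : 2 ≤ L + S) (hi : i < L + S) (γ : ℝ) (m : ℕ) :
    phiLS L S γ (i + blockModulus L S i * m)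
      = bcoef L γ i * γ + blockLength L γ i * phiLS L S γ m := by
  unfold blockModulus blockLength
  split_ifs with h
  · exact phiLS_digit_add hL hLS hi γ m
  · have h0 := phiLS_digit_add hL hLS (i := 0) (by omega) γ m
    rw [zero_add] at h0
    rw [pow_two, mul_assoc, phiLS_digit_add hL hLS hi, h0]
    simp [bcoef, show 0 < L by omega]
    ring

theorem bcoef_succ (L : ℕ) (γ : ℝ) (i : ℕ) :
    bcoef L γ (i + 1) * γ = bcoef L γ i * γ + blockLength L γ i := by
  unfold bcoef blockLength
  by_cases h : i < L
  · by_cases h' : i + 1 < L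
    · simp [h, h']; ring
    · have : (L : ℝ) = i + 1 := by exact_mod_cast (by omega : L = i + 1)
      simp [h, h', this]; ring
  · simp [h, show ¬ i + 1 < L by omega]; ring

theorem bcoef_zero {L : ℕ} (hL : 1 ≤ L) (γ : ℝ) : bcoef L γ 0 = 0 := by
  simp [bcoef, show 0 < L by omega]

theorem bcoef_add {L S : ℕ} {γ : ℝ} (hγ : (L : ℝ) * γ + (S : ℝ) * γ ^ 2 = 1) :
    bcoef L γ (L + S) * γ = 1 := by
  simp [bcoef]
  linarith

theorem sum_blockLength {L : ℕ} (hL : 1 ≤ L) (γ : ℝ) (j : ℕ) :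
    ∑ i ∈ range j, blockLength L γ i = bcoef L γ j * γ := by
  induction j with
  | zero => simp [bcoef_zero hL]
  | succ j ih => rw [sum_range_succ, ih, bcoef_succ]

theorem blockLength_pos {L : ℕ} {γ : ℝ} (hγ : 0 < γ) (i : ℕ) : 0 < blockLength L γ i := by
  unfold blockLength
  split_ifs <;> positivity

theorem bcoef_mul_le {L : ℕ} {γ : ℝ} (hγ : 0 < γ) {i j : ℕ} (h : i ≤ j) :
    bcoef L γ i * γ ≤ bcoef L γ j * γ :=
  monotone_nat_of_le_succ (f := fun i => bcoef L γ i * γ)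
    (fun i => by rw [bcoef_succ]; linarith [blockLength_pos (L := L) hγ i]) h

theorem eq_block {L S n : ℕ} (hLS : 2 ≤ L + S) (hn : memNLS L S n) :
    n = n % (L + S) + blockModulus L S (n % (L + S)) * (n / blockModulus L S (n % (L + S))) := by
  have h := mod_blockModulus hLS (Nat.mod_lt n (by omega)) hn rfl
  conv_lhs => rw [← Nat.mod_add_div n (blockModulus L S (n % (L + S))), h]

theorem phiLS_mem_Ico {L S : ℕ} (hL : 1 ≤ L) (hLS : 2 ≤ L + S) {γ : ℝ} (hγ0 : 0 < γ)
    (hγ : (L : ℝ) * γ + (S : ℝ) * γ ^ 2 = 1) (n : ℕ) (hn : memNLS L S n) :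
    0 ≤ phiLS L S γ n ∧ phiLS L S γ n < 1 := by
  induction n using Nat.strong_induction_on with
  | _ n ih =>
    rcases Nat.eq_zero_or_pos n with rfl | hpos
    · simp [phiLS]
    have hi : n % (L + S) < L + S := Nat.mod_lt n (by omega)
    have hq := eq_block hLS hn
    have hm : n / blockModulus L S (n % (L + S)) < n := by
      refine Nat.div_lt_self hpos ?_
      unfold blockModulus
      split_ifs <;> nlinarith
    generalize n / blockModulus L S (n % (L + S)) = m at hq hm
    generalize n % (L + S) = i at hq hi
    have hmem : memNLS L S m := by rwa [hq, memNLS_block hL hLS hi] at hn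
    obtain ⟨h0, h1⟩ := ih m hm hmem
    rw [hq, phiLS_block hL hLS hi]
    have hw := blockLength_pos (L := L) hγ0 i
    have hb := bcoef_mul_le (L := L) hγ0 (Nat.zero_le i)
    have hb' := bcoef_mul_le (L := L) hγ0 (Nat.succ_le_of_lt hi)
    rw [bcoef_add hγ, bcoef_succ] at hb'
    rw [bcoef_zero hL, zero_mul] at hb
    constructor <;> nlinarith

theorem countBelow_memNLS_block {L S i : ℕ} (hL : 1 ≤ L) (hLS : 2 ≤ L + S) (hi : i < L + S)
    (X : ℕ) :
    countBelow (memNLS L S) (X / blockModulus L S i)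
        ≤ countBelow (fun n => memNLS L S n ∧ n % (L + S) = i) X ∧
      countBelow (fun n => memNLS L S n ∧ n % (L + S) = i) X
        ≤ countBelow (memNLS L S) (X / blockModulus L S i) + 1 := by
  refine countBelow_progression (lt_blockModulus hi)
    (fun n hn => mod_blockModulus hLS hi hn.1 hn.2) (fun m => ?_) X
  simp [memNLS_block hL hLS hi, add_blockModulus_mod hi]

theorem sum_countBelow_blockModulus (L S X : ℕ) :
    ∑ i ∈ range (L + S), countBelow (memNLS L S) (X / blockModulus L S i)
      = L * countBelow (memNLS L S) (X / (L + S))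
        + S * countBelow (memNLS L S) (X / (L + S) ^ 2) := by
  rw [sum_range_add]
  congr 1
  · rw [sum_congr rfl fun i hi => by rw [blockModulus, if_pos (mem_range.1 hi)]]
    simp
  · simp [blockModulus]

theorem countBelow_memNLS_recursion {L S : ℕ} (hL : 1 ≤ L) (hLS : 2 ≤ L + S) (X : ℕ) :
    L * countBelow (memNLS L S) (X / (L + S)) + S * countBelow (memNLS L S) (X / (L + S) ^ 2)
        ≤ countBelow (memNLS L S) X ∧
      countBelow (memNLS L S) X
        ≤ L * countBelow (memNLS L S) (X / (L + S))
          + S * countBelow (memNLS L S) (X / (L + S) ^ 2) + (L + S) := by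
  rw [countBelow_eq_sum _ (B := L + S) (by omega) X, ← sum_countBelow_blockModulus]
  constructor
  · exact sum_le_sum fun i hi => (countBelow_memNLS_block hL hLS (mem_range.1 hi) X).1
  · calc _ ≤ ∑ i ∈ range (L + S), (countBelow (memNLS L S) (X / blockModulus L S i) + 1) :=
        sum_le_sum fun i hi => (countBelow_memNLS_block hL hLS (mem_range.1 hi) X).2
      _ = _ := by simp [sum_add_distrib]

theorem mul_lt_one_of_le {L S : ℕ} (hSL : S ≤ L) {γ : ℝ} (hγ0 : 0 < γ)
    (hγ : (L : ℝ) * γ + (S : ℝ) * γ ^ 2 = 1) : γ * S < 1 := by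
  rcases Nat.eq_zero_or_pos S with rfl | hS
  · simp
  · have h1 : (S : ℝ) ≤ L := by exact_mod_cast hSL
    have h2 : (0 : ℝ) < S * γ ^ 2 := by positivity
    nlinarith

/-- The counting function of `ℕ_{L,S}` scales by `γ` under division by `L + S`, up to a bounded
error. -/
theorem exists_abs_countBelow_div_sub_le {L S : ℕ} (hL : 1 ≤ L) (hLS : 2 ≤ L + S) (hSL : S ≤ L)
    {γ : ℝ} (hγ0 : 0 < γ) (hγ1 : γ < 1) (hγ : (L : ℝ) * γ + (S : ℝ) * γ ^ 2 = 1) :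
    ∃ K : ℝ, 0 ≤ K ∧ ∀ X : ℕ,
      |(countBelow (memNLS L S) (X / (L + S)) : ℝ) - γ * countBelow (memNLS L S) X| ≤ K := by
  have hβ := mul_lt_one_of_le hSL hγ0 hγ
  have hpos : 0 < 1 - γ * S := by linarith
  have hK : 0 ≤ ((L : ℝ) + S) / (1 - γ * S) := by positivity
  refine ⟨(L + S) / (1 - γ * S), hK, fun X => ?_⟩
  have hKeq : ((L : ℝ) + S) / (1 - γ * S) * (1 - γ * S) = L + S := div_mul_cancel₀ _ hpos.ne'
  generalize ((L : ℝ) + S) / (1 - γ * S) = K at hK hKeq ⊢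
  induction X using Nat.strong_induction_on with
  | _ X ih =>
    rcases Nat.eq_zero_or_pos X with rfl | hX
    · simpa [countBelow_zero] using hK
    have hE := ih (X / (L + S)) (Nat.div_lt_self hX (by omega))
    rw [Nat.div_div_eq_div_mul, ← pow_two] at hE
    obtain ⟨h1, h2⟩ := countBelow_memNLS_recursion hL hLS X
    generalize countBelow (memNLS L S) X = a at *
    generalize countBelow (memNLS L S) (X / (L + S)) = b at *
    generalize countBelow (memNLS L S) (X / (L + S) ^ 2) = c at *
    have h1' : (L : ℝ) * b + S * c ≤ a := by exact_mod_cast h1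
    have h2' : (a : ℝ) ≤ L * b + S * c + (L + S) := by exact_mod_cast h2
    have key : (b : ℝ) - γ * a = -(γ * S * (c - γ * b)) - γ * (a - (L * b + S * c)) := by
      linear_combination (b : ℝ) * (-hγ)
    have hS : 0 ≤ γ * S := by positivity
    have hLS0 : (0 : ℝ) ≤ L + S := by positivity
    have hE' := abs_le.1 hE
    rw [abs_le, key]
    have e1 : γ * S * (c - γ * b) ≤ γ * S * K := mul_le_mul_of_nonneg_left hE'.2 hS
    have e2 : γ * S * (-K) ≤ γ * S * (c - γ * b) := mul_le_mul_of_nonneg_left hE'.1 hS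
    have e3 : γ * (a - (L * b + S * c)) ≤ L + S := by nlinarith
    have e4 : 0 ≤ γ * (a - (L * b + S * c)) := mul_nonneg hγ0.le (by linarith)
    constructor <;> nlinarith

theorem exists_abs_countBelow_block_sub_le {L S : ℕ} (hL : 1 ≤ L) (hLS : 2 ≤ L + S) (hSL : S ≤ L)
    {γ : ℝ} (hγ0 : 0 < γ) (hγ1 : γ < 1) (hγ : (L : ℝ) * γ + (S : ℝ) * γ ^ 2 = 1) :
    ∃ K : ℝ, 0 ≤ K ∧ ∀ X i : ℕ,
      |(countBelow (memNLS L S) (X / blockModulus L S i) : ℝ)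
        - blockLength L γ i * countBelow (memNLS L S) X| ≤ K := by
  obtain ⟨K, hK, h⟩ := exists_abs_countBelow_div_sub_le hL hLS hSL hγ0 hγ1 hγ
  refine ⟨2 * K, by linarith, fun X i => ?_⟩
  have h1 := h X
  have h2 := h (X / (L + S))
  rw [Nat.div_div_eq_div_mul, ← pow_two] at h2
  unfold blockModulus blockLength
  split_ifs
  · linarith
  · rw [abs_le] at *
    constructor <;> nlinarith

theorem exists_block {L S : ℕ} (hL : 1 ≤ L) {γ : ℝ} (hγ : (L : ℝ) * γ + (S : ℝ) * γ ^ 2 = 1)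
    {y : ℝ} (hy0 : 0 ≤ y) (hy1 : y < 1) :
    ∃ j < L + S, bcoef L γ j * γ ≤ y ∧ y < bcoef L γ (j + 1) * γ := by
  classical
  have hex : ∃ j, y < bcoef L γ j * γ := ⟨L + S, by rwa [bcoef_add hγ]⟩
  have hlt := Nat.find_spec hex
  have hle : Nat.find hex ≤ L + S := Nat.find_min' hex (by rwa [bcoef_add hγ])
  have hmin := fun j => Nat.find_min hex (m := j)
  generalize Nat.find hex = j at *
  cases j with
  | zero => rw [bcoef_zero hL] at hlt; linarith
  | succ j => exact ⟨j, by omega, not_lt.1 (hmin j (by omega)), hlt⟩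

/-- The points with index below `X` in `[0, y)`, for `y` in the `j`-th elementary interval, split
into full elementary intervals and a rescaled copy of the sequence. -/
theorem countBelow_phiLS_split {L S : ℕ} (hL : 1 ≤ L) (hLS : 2 ≤ L + S) {γ : ℝ} (hγ0 : 0 < γ)
    (hγ : (L : ℝ) * γ + (S : ℝ) * γ ^ 2 = 1) {j : ℕ} (hj : j < L + S) {z : ℝ} (hz0 : 0 ≤ z)
    (hz1 : z < 1) (X : ℕ) :
    countBelow (fun n => memNLS L S n ∧
        phiLS L S γ n < bcoef L γ j * γ + blockLength L γ j * z) X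
      = ∑ i ∈ range j, countBelow (fun n => memNLS L S n ∧ n % (L + S) = i) X
        + countBelow (fun n => (memNLS L S n ∧ n % (L + S) = j) ∧
            phiLS L S γ n < bcoef L γ j * γ + blockLength L γ j * z) X := by
  have hphi : ∀ n, memNLS L S n →
      bcoef L γ (n % (L + S)) * γ ≤ phiLS L S γ n ∧
        phiLS L S γ n < bcoef L γ (n % (L + S) + 1) * γ := by
    intro n hn
    have hi : n % (L + S) < L + S := Nat.mod_lt n (by omega)
    have hq := eq_block hLS hn
    generalize n / blockModulus L S (n % (L + S)) = m at hq
    generalize n % (L + S) = i at hq hi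
    have hmem : memNLS L S m := by rwa [hq, memNLS_block hL hLS hi] at hn
    obtain ⟨h0, h1⟩ := phiLS_mem_Ico hL hLS hγ0 hγ m hmem
    have hw := blockLength_pos (L := L) hγ0 i
    rw [hq, phiLS_block hL hLS hi, bcoef_succ]
    constructor <;> nlinarith
  have hw := blockLength_pos (L := L) hγ0 j
  have hyj : bcoef L γ j * γ + blockLength L γ j * z < bcoef L γ (j + 1) * γ := by
    rw [bcoef_succ]; nlinarith
  have hy0 : bcoef L γ j * γ ≤ bcoef L γ j * γ + blockLength L γ j * z := by
    nlinarith
  generalize bcoef L γ j * γ + blockLength L γ j * z = y at *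
  rw [countBelow_eq_sum _ (B := L + S) (by omega) X,
    ← sum_subset (range_subset_range.2 (Nat.succ_le_of_lt hj)), sum_range_succ]
  · congr 1
    · refine sum_congr rfl fun i hi => countBelow_congr (fun n => ?_) X
      constructor
      · rintro ⟨⟨h1, -⟩, h2⟩; exact ⟨h1, h2⟩
      · rintro ⟨h1, h2⟩
        refine ⟨⟨h1, (hphi n h1).2.trans_le (le_trans ?_ hy0)⟩, h2⟩
        rw [h2]
        exact bcoef_mul_le hγ0 (Nat.succ_le_of_lt (mem_range.1 hi))
    · exact countBelow_congr (fun n => by tauto) X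
  · intro i _ hi
    rw [mem_range, not_lt] at hi
    have hfalse : ∀ n, ¬((memNLS L S n ∧ phiLS L S γ n < y) ∧ n % (L + S) = i) := by
      rintro n ⟨⟨h1, h2⟩, h3⟩
      have h4 := (hphi n h1).1
      rw [h3] at h4
      have := bcoef_mul_le (L := L) hγ0 hi
      linarith
    simp [countBelow, hfalse]

theorem length_digits_div_add_one {B : ℕ} (hB : 2 ≤ B) {X : ℕ} (hX : 0 < X) :
    (Nat.digits B (X / B)).length + 1 = (Nat.digits B X).length := by
  rw [Nat.digits_def' (by omega) hX, List.length_cons]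

theorem length_digits_div_blockModulus {L S X : ℕ} (hLS : 2 ≤ L + S) (hX : 0 < X) (i : ℕ) :
    (Nat.digits (L + S) (X / blockModulus L S i)).length + 1
      ≤ (Nat.digits (L + S) X).length := by
  have h1 := length_digits_div_add_one hLS hX
  unfold blockModulus
  split_ifs
  · exact h1.le
  · rw [pow_two, ← Nat.div_div_eq_div_mul]
    rcases Nat.eq_zero_or_pos (X / (L + S)) with h | h
    · rw [h] at h1 ⊢
      simp only [Nat.zero_div]
      exact h1.le
    · have := length_digits_div_add_one hLS h
      omega

/-- The local discrepancy of the points with index below `X` grows at most linearly in the number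
of digits of `X`. -/
theorem exists_abs_localDiscrepancy_le {L S : ℕ} (hL : 1 ≤ L) (hLS : 2 ≤ L + S) (hSL : S ≤ L)
    {γ : ℝ} (hγ0 : 0 < γ) (hγ1 : γ < 1) (hγ : (L : ℝ) * γ + (S : ℝ) * γ ^ 2 = 1) :
    ∃ C : ℝ, 0 ≤ C ∧ ∀ (X : ℕ) (y : ℝ), 0 ≤ y → y ≤ 1 →
      |(countBelow (fun n => memNLS L S n ∧ phiLS L S γ n < y) X : ℝ)
        - y * countBelow (memNLS L S) X| ≤ C * (Nat.digits (L + S) X).length := by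
  obtain ⟨K, hK, hblock⟩ := exists_abs_countBelow_block_sub_le hL hLS hSL hγ0 hγ1 hγ
  refine ⟨(L + S) * (K + 1) + (K + 1), by positivity, fun X => ?_⟩
  induction X using Nat.strong_induction_on with
  | _ X ih =>
    intro y hy0 hy1
    rcases Nat.eq_zero_or_pos X with rfl | hX
    · simp [countBelow_zero]
    rcases hy1.eq_or_lt with rfl | hy1
    · rw [countBelow_congr (Q := memNLS L S) fun n =>
        ⟨And.left, fun h => ⟨h, (phiLS_mem_Ico hL hLS hγ0 hγ n h).2⟩⟩]
      simp only [one_mul, sub_self, abs_zero]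
      positivity
    obtain ⟨j, hj, hjy, hyj⟩ := exists_block hL hγ hy0 hy1
    have hw := blockLength_pos (L := L) hγ0 j
    obtain ⟨z, rfl⟩ : ∃ z, y = bcoef L γ j * γ + blockLength L γ j * z :=
      ⟨(y - bcoef L γ j * γ) / blockLength L γ j, by field_simp; ring⟩
    have hz0 : 0 ≤ z := by
      by_contra hz
      nlinarith
    have hz1 : z < 1 := by
      rw [bcoef_succ] at hyj
      by_contra hz
      nlinarith
    rw [countBelow_phiLS_split hL hLS hγ0 hγ hj hz0 hz1]
    have hlt : X / blockModulus L S j < X :=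
      Nat.div_lt_self hX (by unfold blockModulus; split_ifs <;> nlinarith)
    have hlen := length_digits_div_blockModulus hLS hX j
    have hrec := ih _ hlt z hz0 hz1.le
    have hprog := countBelow_progression
      (P := fun n => (memNLS L S n ∧ n % (L + S) = j) ∧
        phiLS L S γ n < bcoef L γ j * γ + blockLength L γ j * z)
      (Q := fun n => memNLS L S n ∧ phiLS L S γ n < z)
      (lt_blockModulus hj) (fun n hn => mod_blockModulus hLS hj hn.1.1 hn.1.2)
      (fun m => by
        simp [memNLS_block hL hLS hj, add_blockModulus_mod hj, phiLS_block hL hLS hj, hw]) X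
    have hbj := hblock X j
    have hsum : |(∑ i ∈ range j,
          (countBelow (fun n => memNLS L S n ∧ n % (L + S) = i) X : ℝ))
        - bcoef L γ j * γ * countBelow (memNLS L S) X| ≤ (L + S) * (K + 1) := by
      rw [← sum_blockLength hL, sum_mul, ← sum_sub_distrib]
      calc _ ≤ ∑ i ∈ range j, (K + 1) := by
            refine (abs_sum_le_sum_abs _ _).trans (sum_le_sum fun i hi => ?_)
            obtain ⟨h1, h2⟩ := countBelow_memNLS_block hL hLS ((mem_range.1 hi).trans hj) X
            have h1' : (_ : ℝ) ≤ _ := Nat.cast_le.2 h1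
            have h2' : (_ : ℝ) ≤ _ := Nat.cast_le.2 h2
            push_cast at h2'
            have h3 := abs_le.1 (hblock X i)
            rw [abs_le]
            constructor <;> linarith
        _ = j * (K + 1) := by rw [sum_const, card_range, nsmul_eq_mul]
        _ ≤ _ := by
            have : (j : ℝ) ≤ L + S := by exact_mod_cast hj.le
            gcongr
    push_cast
    obtain ⟨h1, h2⟩ := hprog
    generalize countBelow (fun n => (memNLS L S n ∧ n % (L + S) = j) ∧
        phiLS L S γ n < bcoef L γ j * γ + blockLength L γ j * z) X = p at *
    generalize countBelow (fun n => memNLS L S n ∧ phiLS L S γ n < z)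
      (X / blockModulus L S j) = r at *
    generalize countBelow (memNLS L S) (X / blockModulus L S j) = g at *
    generalize countBelow (memNLS L S) X = G at *
    generalize (∑ i ∈ range j,
      (countBelow (fun n => memNLS L S n ∧ n % (L + S) = i) X : ℝ)) = s at *
    generalize (Nat.digits (L + S) (X / blockModulus L S j)).length = d at *
    generalize (Nat.digits (L + S) X).length = D at *
    have h1' : (r : ℝ) ≤ p := by exact_mod_cast h1
    have h2' : (p : ℝ) ≤ r + 1 := by exact_mod_cast h2
    have hlen' : (d : ℝ) + 1 ≤ D := by exact_mod_cast hlen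
    have hC : 0 ≤ ((L : ℝ) + S) * (K + 1) + (K + 1) := by positivity
    have hCd := mul_le_mul_of_nonneg_left hlen' hC
    have hzK : |z * (g - blockLength L γ j * G)| ≤ K := by
      rw [abs_mul, abs_of_nonneg hz0]
      nlinarith [abs_nonneg ((g : ℝ) - blockLength L γ j * G)]
    rw [abs_le] at *
    constructor <;> nlinarith

theorem two_pow_length_digits_le {L S : ℕ} (hL : 1 ≤ L) (hLS : 2 ≤ L + S) {X : ℕ} (hX : 0 < X) :
    2 ^ (Nat.digits (L + S) X).length ≤ 4 * countBelow (memNLS L S) X ^ 2 := by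
  have hpos : ∀ Y, 0 < Y → 1 ≤ countBelow (memNLS L S) Y := fun Y hY => by
    classical
    exact card_pos.2 ⟨0, by simp [hY, memNLS_zero]⟩
  induction X using Nat.strong_induction_on with
  | _ X ih =>
    have h1 := length_digits_div_add_one hLS hX
    rcases Nat.eq_zero_or_pos (X / (L + S)) with h | h
    · rw [← h1, h]
      have := Nat.one_le_pow 2 _ (hpos X hX)
      simp only [Nat.digits_zero, List.length_nil]
      norm_num
      linarith
    have h2 := length_digits_div_add_one hLS h
    rw [← h1, ← h2]
    rcases Nat.eq_zero_or_pos (X / (L + S) / (L + S)) with h' | h'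
    · have := Nat.one_le_pow 2 _ (hpos X hX)
      rw [h']
      simp only [Nat.digits_zero, List.length_nil]
      norm_num
      linarith
    have h3 := ih (X / (L + S) / (L + S))
      ((Nat.div_le_self _ _).trans_lt (Nat.div_lt_self hX (by omega))) h'
    have h4 := (countBelow_memNLS_recursion hL hLS X).1
    have h5 : countBelow (memNLS L S) (X / (L + S) / (L + S))
        ≤ countBelow (memNLS L S) (X / (L + S)) :=
      countBelow_mono (fun _ h => h) (Nat.div_le_self _ _)
    rw [pow_two (L + S), ← Nat.div_div_eq_div_mul] at h4
    generalize countBelow (memNLS L S) (X / (L + S) / (L + S)) = c at *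
    generalize countBelow (memNLS L S) (X / (L + S)) = b at *
    generalize countBelow (memNLS L S) X = a at *
    have h6 : 2 * c ≤ a := by nlinarith
    have h7 : (2 * c) ^ 2 ≤ a ^ 2 := Nat.pow_le_pow_left h6 2
    rw [pow_succ, pow_succ]
    nlinarith

theorem infinite_memNLS {L S : ℕ} (hL : 1 ≤ L) (hLS : 2 ≤ L + S) :
    (Set.ofPred (memNLS L S)).Infinite := by
  refine Set.infinite_of_injective_forall_mem (f := fun k => (L + S) ^ k)
    (Nat.pow_right_injective hLS) fun k => ?_
  rw [Set.mem_ofPred_eq]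
  induction k with
  | zero =>
    rw [pow_zero, memNLS_iff_isChain, Nat.digits_of_lt _ _ one_ne_zero (by omega)]
    exact List.isChain_singleton _
  | succ k ih => rwa [pow_succ', memNLS_mul hL hLS]

theorem countBelow_nth {P : ℕ → Prop} (hP : (Set.ofPred P).Infinite) (Q : ℕ → Prop) (N : ℕ) :
    countBelow (fun n => P n ∧ Q n) (Nat.nth P N) = countBelow (fun j => Q (Nat.nth P j)) N := by
  classical
  unfold countBelow
  symm
  refine card_bij (fun j _ => Nat.nth P j) (fun j hj => ?_)
    (fun _ _ _ _ h => Nat.nth_injective hP h) fun n hn => ?_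
  · simp only [mem_filter, mem_range] at hj ⊢
    exact ⟨(Nat.nth_lt_nth hP).2 hj.1, Nat.nth_mem_of_infinite hP j, hj.2⟩
  · simp only [mem_filter, mem_range] at hn
    have h := Nat.nth_count hn.2.1
    refine ⟨Nat.count P n, ?_, h⟩
    simp only [mem_filter, mem_range, h]
    exact ⟨(Nat.nth_lt_nth hP).1 (by rw [h]; exact hn.1), hn.2.2⟩

theorem countP_map_range (f : ℕ → ℝ) (p : ℝ → Prop) [DecidablePred p] (N : ℕ) :
    ((List.range N).map f).countP (fun y => decide (p y)) = countBelow (fun j => p (f j)) N := by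
  induction N with
  | zero => simp [countBelow]
  | succ N ih =>
    classical
    rw [List.range_succ, List.map_append, List.countP_append, ih]
    unfold countBelow
    rw [range_add_one, filter_insert]
    by_cases h : p (f N) <;> simp [h]

theorem countBelow_Ico (P : ℕ → Prop) (f : ℕ → ℝ) {a b : ℝ} (hab : a ≤ b) (X : ℕ) :
    countBelow (fun n => P n ∧ f n < b) X
      = countBelow (fun n => P n ∧ f n < a) X + countBelow (fun n => P n ∧ a ≤ f n ∧ f n < b) X := by
  classical
  unfold countBelow
  rw [← card_union_of_disjoint]
  · congr 1
    ext n
    simp only [mem_filter, mem_union]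
    constructor
    · rintro ⟨h1, h2, h3⟩
      rcases lt_or_ge (f n) a with h | h
      · exact Or.inl ⟨h1, h2, h⟩
      · exact Or.inr ⟨h1, h2, h, h3⟩
    · rintro (⟨h1, h2, h3⟩ | ⟨h1, h2, -, h3⟩)
      · exact ⟨h1, h2, h3.trans_le hab⟩
      · exact ⟨h1, h2, h3⟩
  · rw [disjoint_left]
    intro n h h'
    simp only [mem_filter] at h h'
    linarith [h.2.2, h'.2.2.1]

/-- If `S ≤ L`, there exists a constant `k > 0` such that for every
`N ≥ 2`, `N · D(ξ_1, …, ξ_N) ≤ k · log N`: the LS-sequence of points has low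
discrepancy. -/
theorem stmt_13 (L S : ℕ) (hL : 1 ≤ L) (hLS : 2 ≤ L + S) (hSL : S ≤ L)
    (γ : ℝ) (hγ0 : 0 < γ) (hγ1 : γ < 1)
    (hγeq : (L : ℝ) * γ + (S : ℝ) * γ ^ 2 = 1) :
    ∃ k > (0 : ℝ), ∀ N : ℕ, 2 ≤ N →
      (N : ℝ) * discList (lsPoints L S γ N) ≤ k * Real.log N := by
  obtain ⟨C, hC, hdisc⟩ := exists_abs_localDiscrepancy_le hL hLS hSL hγ0 hγ1 hγeq
  have hlog2 : 0 < Real.log 2 := Real.log_pos one_lt_two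
  refine ⟨2 * C * (4 / Real.log 2) + 1, by positivity, fun N hN => ?_⟩
  have hinf := infinite_memNLS hL hLS
  have hN0 : (0 : ℝ) < N := by exact_mod_cast (by omega : 0 < N)
  have hlogN : Real.log 2 ≤ Real.log N := Real.log_le_log two_pos (by exact_mod_cast hN)
  have hX : 0 < Nat.nth (memNLS L S) N :=
    (Nat.zero_le _).trans_lt ((Nat.nth_lt_nth hinf).2 (by omega : 0 < N))
  have hcount : countBelow (memNLS L S) (Nat.nth (memNLS L S) N) = N := by
    rw [countBelow_congr (Q := fun n => memNLS L S n ∧ True) fun n => (and_iff_left trivial).symm,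
      countBelow_nth hinf fun _ => True]
    simp [countBelow]
  have hlen : ((Nat.digits (L + S) (Nat.nth (memNLS L S) N)).length : ℝ)
      ≤ 4 / Real.log 2 * Real.log N := by
    have h := two_pow_length_digits_le hL hLS hX
    rw [hcount] at h
    have h' : (2 : ℝ) ^ (Nat.digits (L + S) (Nat.nth (memNLS L S) N)).length
        ≤ 2 ^ 2 * (N : ℝ) ^ 2 := by
      norm_num
      exact_mod_cast h
    have h'' := Real.log_le_log (by positivity) h'
    rw [Real.log_mul (by positivity) (by positivity), Real.log_pow, Real.log_pow, Real.log_pow]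
      at h''
    rw [div_mul_eq_mul_div, le_div_iff₀ hlog2]
    push_cast at h''
    linarith
  have hbound : 2 * (C * (Nat.digits (L + S) (Nat.nth (memNLS L S) N)).length)
      ≤ (2 * C * (4 / Real.log 2) + 1) * Real.log N := by
    nlinarith [mul_le_mul_of_nonneg_left hlen hC]
  rw [mul_comm, ← le_div_iff₀ hN0]
  refine Real.sSup_le ?_ (by positivity)
  rintro d ⟨a, b, ha, hab, hb, rfl⟩
  rw [le_div_iff₀ hN0]
  refine le_trans ?_ hbound
  have hA := hdisc (Nat.nth (memNLS L S) N) a ha (by linarith)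
  have hB := hdisc (Nat.nth (memNLS L S) N) b (by linarith) hb
  rw [hcount] at hA hB
  rw [countBelow_Ico _ _ hab.le, countBelow_nth hinf fun n => a ≤ phiLS L S γ n ∧ phiLS L S γ n < b]
    at hB
  unfold lsPoints
  rw [countP_map_range _ fun y => a ≤ y ∧ y < b, List.length_map, List.length_range]
  nth_rewrite 2 [← abs_of_pos hN0]
  rw [← abs_mul, sub_mul, div_mul_cancel₀ _ hN0.ne']
  push_cast at hB
  rw [abs_le] at *
  constructor <;> linarith
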